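/- Let N ≥ 3 and let α be a real number with 0 ≤ α < N − 2. Then for every u ∈ C_c^∞(ℍ^N∖{o}) one has ∫_{ℍ^N} (Δ_r u)²/r^{α−2} dv ≥ ((N−2−α)²(N−2+α)²/16) ∫_{ℍ^N} u²/r^{α+2} dv + ((N−2−α)(N−2+α)(N−1)/8) ∫_{ℍ^N} u²/r^α dv. -/

import Mathlib

open MeasureTheory Real Set

noncomputable section

/-- The radial derivative `∇_r u = ∂u/∂r` of a function `u(r,σ)`. -/
def radGrad (N : ℕ) (u : ℝ → EuclideanSpace ℝ (Fin N) → ℝ) :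
    ℝ → EuclideanSpace ℝ (Fin N) → ℝ :=
  fun r σ => deriv (fun s => u s σ) r

/-- The radial Laplacian `Δ_r u = ∂²u/∂r² + (N-1) coth r · ∂u/∂r`. -/
def radLap (N : ℕ) (u : ℝ → EuclideanSpace ℝ (Fin N) → ℝ) :
    ℝ → EuclideanSpace ℝ (Fin N) → ℝ :=
  fun r σ => deriv (fun s => deriv (fun t => u t σ) s) r
    + ((N : ℝ) - 1) * (Real.cosh r / Real.sinh r) * deriv (fun s => u s σ) r

/-- The higher order radial derivative `∇_r^k u`: `Δ_r^{k/2} u` for even `k`,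
`∂_r (Δ_r^{(k-1)/2} u)` for odd `k`. -/
def radPow (N k : ℕ) (u : ℝ → EuclideanSpace ℝ (Fin N) → ℝ) :
    ℝ → EuclideanSpace ℝ (Fin N) → ℝ :=
  if Even k then (radLap N)^[k / 2] u else radGrad N ((radLap N)^[k / 2] u)

/-- The integral over the hyperbolic space `ℍ^N` in polar coordinates:
`∫_{S^{N-1}} ∫_0^∞ F(r,σ) (sinh r)^{N-1} dr dσ`, where `dσ` is the standard
surface measure (the `(N-1)`-dimensional Hausdorff measure) on the unit sphere. -/
def hypInt (N : ℕ) (F : ℝ → EuclideanSpace ℝ (Fin N) → ℝ) : ℝ :=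
  ∫ σ in Metric.sphere (0 : EuclideanSpace ℝ (Fin N)) 1,
    (∫ r in Ioi (0 : ℝ), F r σ * Real.sinh r ^ (N - 1)) ∂μH[(N : ℝ) - 1]

/-- `u ∈ C_c^∞(ℍ^N)`: `u(r,σ)` smooth (including at the pole `r = 0`) and
vanishing for all `r` larger than some `R`. -/
def IsCc (N : ℕ) (u : ℝ → EuclideanSpace ℝ (Fin N) → ℝ) : Prop :=
  ContDiff ℝ (⊤ : ℕ∞) (Function.uncurry u) ∧
  ∃ R : ℝ, ∀ r : ℝ, R < r → ∀ σ ∈ Metric.sphere (0 : EuclideanSpace ℝ (Fin N)) 1, u r σ = 0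

/-- `u ∈ C_c^∞(ℍ^N \ {o})`: `u(r,σ)` smooth with support contained in
`[a,b] × S^{N-1}` for some `0 < a ≤ b`. -/
def IsCcAway (N : ℕ) (u : ℝ → EuclideanSpace ℝ (Fin N) → ℝ) : Prop :=
  ContDiff ℝ (⊤ : ℕ∞) (Function.uncurry u) ∧
  ∃ a b : ℝ, 0 < a ∧ a ≤ b ∧
    ∀ r : ℝ, r ∉ Icc a b → ∀ σ ∈ Metric.sphere (0 : EuclideanSpace ℝ (Fin N)) 1, u r σ = 0

/-- The unit sphere of `ℝ^N` has finite `(N-1)`-dimensional Hausdorff measure. -/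
theorem hausdorffMeasure_sphere_lt_top (N : ℕ) (hN : 1 ≤ N) :
    μH[(N : ℝ) - 1] (Metric.sphere (0 : EuclideanSpace ℝ (Fin N)) 1) < ⊤ := by
  obtain ⟨n, rfl⟩ : ∃ n, N = n + 1 := ⟨N - 1, by omega⟩
  have hcast : (((n + 1 : ℕ) : ℝ) - 1) = (n : ℝ) := by push_cast; ring
  rw [hcast]
  have cap : ∀ v : EuclideanSpace ℝ (Fin (n + 1)), ‖v‖ = 1 →
      μH[(n : ℝ)] (Metric.sphere (0 : EuclideanSpace ℝ (Fin (n + 1))) 1 ∩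
        {x | inner ℝ v x ≤ 0}) < ⊤ := by
    intro v hv
    have hv0 : v ≠ 0 := by rintro rfl; simp at hv
    have : Fact (Module.finrank ℝ (EuclideanSpace ℝ (Fin (n + 1))) = n + 1) := ⟨by simp⟩
    let L : (ℝ ∙ v)ᗮ ≃L[ℝ] (Fin n → ℝ) :=
      ContinuousLinearEquiv.ofFinrankEq (by
        rw [Submodule.finrank_orthogonal_span_singleton (n := n) hv0]; simp)
    let g : (Fin n → ℝ) → EuclideanSpace ℝ (Fin (n + 1)) :=
      fun y => stereoInvFunAux v ((L.symm y : (ℝ ∙ v)ᗮ) : EuclideanSpace ℝ (Fin (n + 1)))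
    have hg : ContDiff ℝ 1 g := contDiff_stereoInvFunAux.comp
      ((ℝ ∙ v)ᗮ.subtypeL.contDiff.comp L.symm.contDiff)
    let K : Set (Fin n → ℝ) := L '' Metric.closedBall 0 2
    have hK : IsCompact K := (isCompact_closedBall _ _).image L.continuous
    obtain ⟨C, hC⟩ :=
      (hg.locallyLipschitz.locallyLipschitzOn (s := K)).exists_lipschitzOnWith_of_compact hK
    have himg : μH[(n : ℝ)] (g '' K) < ⊤ := by
      refine (hC.hausdorffMeasure_image_le (Nat.cast_nonneg n)).trans_lt ?_
      have hvol : μH[(n : ℝ)] K = volume K := by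
        have := hausdorffMeasure_pi_real (ι := Fin n)
        rw [Fintype.card_fin] at this
        rw [this]
      rw [hvol]
      exact ENNReal.mul_lt_top (by simp) hK.measure_lt_top
    refine (measure_mono ?_).trans_lt himg
    rintro x ⟨hx, hvx⟩
    have hvx : inner ℝ v x ≤ 0 := hvx
    have hx1 : ‖x‖ = 1 := by simpa using hx
    have hne : x ≠ v := by
      rintro rfl
      rw [real_inner_self_eq_norm_sq, hx1] at hvx
      norm_num at hvx
    refine ⟨L (stereoToFun v x), ⟨_, ?_, rfl⟩, ?_⟩
    · rw [mem_closedBall_zero_iff, stereoToFun_apply, norm_smul, Real.norm_eq_abs]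
      have h1 : ‖(ℝ ∙ v)ᗮ.orthogonalProjectionOnto x‖ ≤ 1 := by
        simpa [hx1] using (ℝ ∙ v)ᗮ.norm_orthogonalProjectionOnto_apply_le x
      have h2 : |2 / (1 - inner ℝ v x)| ≤ 2 := by
        rw [abs_of_nonneg (by apply div_nonneg <;> linarith), div_le_iff₀ (by linarith)]
        linarith
      calc _ ≤ 2 * (1 : ℝ) := mul_le_mul h2 h1 (norm_nonneg _) (by norm_num)
        _ = 2 := by norm_num
    · have := congrArg Subtype.val (stereo_left_inv hv (x := ⟨x, hx⟩) hne)
      simpa [g, stereoInvFun] using this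
  let e : EuclideanSpace ℝ (Fin (n + 1)) := EuclideanSpace.single 0 1
  have he : ‖e‖ = 1 := by simp [e]
  refine (measure_mono (t := (Metric.sphere 0 1 ∩ {x | inner ℝ e x ≤ 0}) ∪
    (Metric.sphere 0 1 ∩ {x | inner ℝ (-e) x ≤ 0})) ?_).trans_lt
    ((measure_union_le _ _).trans_lt
      (ENNReal.add_lt_top.2 ⟨cap e he, cap (-e) (by rwa [norm_neg])⟩))
  intro x hx
  rcases le_total (inner ℝ e x) 0 with h | h
  · exact Or.inl ⟨hx, h⟩
  · exact Or.inr ⟨hx, by simpa [inner_neg_left] using h⟩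

theorem sinh_le_mul_cosh {r : ℝ} (hr : 0 ≤ r) : sinh r ≤ r * cosh r := by
  have hd : ∀ x : ℝ, HasDerivAt (fun x => x * cosh x - sinh x) (x * sinh x) x := fun x => by
    have := ((hasDerivAt_id x).mul (Real.hasDerivAt_cosh x)).sub (Real.hasDerivAt_sinh x)
    convert! this using 1
    simp
  have hm : MonotoneOn (fun x => x * cosh x - sinh x) (Ici 0) := by
    refine monotoneOn_of_deriv_nonneg (convex_Ici 0)
      (fun x _ => (hd x).continuousAt.continuousWithinAt)
      (fun x _ => (hd x).differentiableAt.differentiableWithinAt) fun x hx => ?_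
    rw [interior_Ici] at hx
    rw [(hd x).deriv]
    exact mul_nonneg (le_of_lt hx) (Real.sinh_nonneg_iff.2 (le_of_lt hx))
  have := hm (mem_Ici.2 le_rfl) (mem_Ici.2 hr) hr
  simp at this
  linarith

theorem one_div_le_coth {r : ℝ} (hr : 0 < r) : 1 / r ≤ cosh r / sinh r := by
  rw [div_le_div_iff₀ hr (Real.sinh_pos_iff.2 hr)]
  linarith [sinh_le_mul_cosh hr.le]

theorem hasDerivAt_coth {r : ℝ} (hr : 0 < r) :
    HasDerivAt (fun x => cosh x / sinh x) (1 - (cosh r / sinh r) ^ 2) r := by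
  have hs : sinh r ≠ 0 := (Real.sinh_pos_iff.2 hr).ne'
  convert! (Real.hasDerivAt_cosh r).div (Real.hasDerivAt_sinh r) hs using 1
  field_simp

theorem hasDerivAt_weight (n : ℕ) (α : ℝ) {r : ℝ} (hr : 0 < r) :
    HasDerivAt (fun x => x ^ (-α) * sinh x ^ n)
      (r ^ (-α) * sinh r ^ n * (-α / r + n * (cosh r / sinh r))) r := by
  have hs : sinh r ≠ 0 := (Real.sinh_pos_iff.2 hr).ne'
  convert! (Real.hasDerivAt_rpow_const (p := -α) (Or.inl hr.ne')).mul
    ((Real.hasDerivAt_sinh r).pow n) using 1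
  rw [Real.rpow_sub_one hr.ne']
  rcases n with _ | n
  · simp; ring
  · simp only [Nat.add_sub_cancel, Pi.pow_apply, pow_succ]
    field_simp

/-- The Rellich integrand dominates a multiple of the derivative of the flux in
`hasDerivAt_rellich_flux`; here `y, z, t` stand for `f` and its first two derivatives, `C` for
`coth r`, and `w` for `r ^ (-α) * sinh r ^ n`. -/
theorem rellich_pointwise {n α r w C y z t l : ℝ} (hn : 2 ≤ n) (hα0 : 0 ≤ α) (hα : α < n - 1)
    (hr : 0 < r) (hw : 0 ≤ w) (hC : 1 / r ≤ C) (hl : l = ((n - 1) ^ 2 - α ^ 2) / 4) :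
    2 * l * (-(w * (-α / r + n * C)) * (y * z + y ^ 2 * (n * C - 1 / r) / 2)
        - w * (z ^ 2 + y * t + y * z * (n * C - 1 / r)
          + y ^ 2 * (n * (1 - C ^ 2) + 1 / r ^ 2) / 2))
      ≤ (t + n * C * z) ^ 2 * (r ^ 2 * w) - l ^ 2 * (y ^ 2 * (w / r ^ 2))
        - l * n / 2 * (y ^ 2 * w) := by
  have hl0 : 0 ≤ l := by rw [hl]; nlinarith
  have h1r : 0 < 1 / r := by positivity
  have hCr : 0 ≤ C ^ 2 - (1 / r) ^ 2 := by nlinarith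
  have key : 0 ≤ w * ((r * (t + n * C * z) + l * y / r) ^ 2
      + 2 * l * (z + (-α / (2 * r) + n * C / 2 - 1 / (2 * r)) * y) ^ 2
      + 2 * l * y ^ 2 * (n / 4 * ((n - 2) * (C ^ 2 - (1 / r) ^ 2) + 1))) := by
    have : 0 ≤ n - 2 := by linarith
    have : 0 ≤ n := by linarith
    positivity
  refine le_of_sub_nonneg (key.trans_eq ?_)
  have hl2 : l * α ^ 2 = l * ((n - 1) ^ 2 - 4 * l) := by rw [hl]; ring
  field_simp
  linear_combination 4 * w * y ^ 2 * hl2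

theorem hasDerivAt_rellich_flux (n : ℕ) (α : ℝ) {f : ℝ → ℝ} (hf : ContDiff ℝ 2 f) {r : ℝ}
    (hr : 0 < r) :
    HasDerivAt (fun x => -(x ^ (-α) * sinh x ^ n) *
        (f x * deriv f x + f x ^ 2 * (n * (cosh x / sinh x) - 1 / x) / 2))
      (-(r ^ (-α) * sinh r ^ n * (-α / r + n * (cosh r / sinh r))) *
          (f r * deriv f r + f r ^ 2 * (n * (cosh r / sinh r) - 1 / r) / 2)
        - r ^ (-α) * sinh r ^ n * (deriv f r ^ 2 + f r * deriv (deriv f) r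
          + f r * deriv f r * (n * (cosh r / sinh r) - 1 / r)
          + f r ^ 2 * (n * (1 - (cosh r / sinh r) ^ 2) + 1 / r ^ 2) / 2)) r := by
  have h0 : HasDerivAt f (deriv f r) r :=
    (hf.differentiable (by norm_num) r).hasDerivAt
  have h1 : HasDerivAt (deriv f) (deriv (deriv f) r) r :=
    ((hf.differentiable_deriv_two) r).hasDerivAt
  have hinv : HasDerivAt (fun x : ℝ => 1 / x) (-(1 / r ^ 2)) r := by
    simpa using hasDerivAt_inv hr.ne'
  have := (hasDerivAt_weight n α hr).neg.mul ((h0.mul h1).add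
    (((h0.pow 2).mul (((hasDerivAt_coth hr).const_mul (n : ℝ)).sub hinv)).div_const 2))
  convert! this using 1
  simp
  ring

/-- The weighted Rellich inequality on a ray. -/
theorem integral_rellich_le {n : ℕ} (hn : 2 ≤ n) {α l a b : ℝ} (hα0 : 0 ≤ α)
    (hα : α < (n : ℝ) - 1) (hl : l = (((n : ℝ) - 1) ^ 2 - α ^ 2) / 4) (ha : 0 < a) (hab : a ≤ b)
    {f : ℝ → ℝ} (hf : ContDiff ℝ 2 f) (hfa : f a = 0) (hfb : f b = 0) :
    l ^ 2 * (∫ r in Icc a b, f r ^ 2 / r ^ (α + 2) * sinh r ^ n)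
      + l * n / 2 * (∫ r in Icc a b, f r ^ 2 / r ^ α * sinh r ^ n)
    ≤ ∫ r in Icc a b,
        (deriv (deriv f) r + n * (cosh r / sinh r) * deriv f r) ^ 2 / r ^ (α - 2)
          * sinh r ^ n := by
  have hpos : ∀ r ∈ Icc a b, 0 < r := fun r hr => ha.trans_le hr.1
  have hf1 : Continuous (deriv f) := hf.continuous_deriv (by norm_num)
  have hf2 : Continuous (deriv (deriv f)) :=
    (((contDiff_succ_iff_deriv (n := 1)).1 hf).2.2).continuous_deriv le_rfl
  have hf0 := hf.continuous
  have hcoth : ContinuousOn (fun r => cosh r / sinh r) (Icc a b) :=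
    fun r hr => (hasDerivAt_coth (hpos r hr)).continuousAt.continuousWithinAt
  have hsinh : ContinuousOn (fun r => sinh r ^ n) (Icc a b) :=
    (Real.continuous_sinh.pow n).continuousOn
  have hpow : ∀ β : ℝ, ContinuousOn (fun r : ℝ => r ^ β) (Icc a b) := fun β r hr =>
    (Real.continuousAt_rpow_const r β (Or.inl (hpos r hr).ne')).continuousWithinAt
  have hpow0 : ∀ β : ℝ, ∀ r ∈ Icc a b, r ^ β ≠ 0 := fun β r hr =>
    (Real.rpow_pos_of_pos (hpos r hr) β).ne'
  have hc : ∀ β : ℝ, ContinuousOn (fun r => f r ^ 2 / r ^ β * sinh r ^ n) (Icc a b) := fun β =>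
    ((hf0.pow 2).continuousOn.div (hpow β) (hpow0 β)).mul hsinh
  have hcL : ContinuousOn (fun r =>
      (deriv (deriv f) r + n * (cosh r / sinh r) * deriv f r) ^ 2 / r ^ (α - 2) * sinh r ^ n)
      (Icc a b) :=
    (((hf2.continuousOn.add ((continuousOn_const.mul hcoth).mul hf1.continuousOn)).pow 2).div
      (hpow _) (hpow0 _)).mul hsinh
  have hi2 := (hc (α + 2)).integrableOn_Icc (μ := volume)
  have hi0 := (hc α).integrableOn_Icc (μ := volume)
  have hiL := hcL.integrableOn_Icc (μ := volume)
  let G : ℝ → ℝ := fun x => -(x ^ (-α) * sinh x ^ n) *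
        (f x * deriv f x + f x ^ 2 * (n * (cosh x / sinh x) - 1 / x) / 2)
  have hG : ∀ r ∈ Icc a b, HasDerivAt G _ r := fun r hr =>
    hasDerivAt_rellich_flux n α hf (hpos r hr)
  have hle := intervalIntegral.sub_le_integral_of_hasDeriv_right_of_le hab
    (g := fun r => 2 * l * G r)
    (φ := fun r =>
      (deriv (deriv f) r + n * (cosh r / sinh r) * deriv f r) ^ 2 / r ^ (α - 2) * sinh r ^ n
      - l ^ 2 * (f r ^ 2 / r ^ (α + 2) * sinh r ^ n)
      - l * n / 2 * (f r ^ 2 / r ^ α * sinh r ^ n))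
    (fun r hr => ((hG r hr).const_mul (2 * l)).continuousAt.continuousWithinAt)
    (fun r hr => ((hG r (Ioo_subset_Icc_self hr)).const_mul (2 * l)).hasDerivWithinAt)
    ((hiL.sub (hi2.const_mul _)).sub (hi0.const_mul _))
    (fun r hr => by
      have hr0 := hpos r (Ioo_subset_Icc_self hr)
      have hs := Real.sinh_pos_iff.2 hr0
      refine (rellich_pointwise (by exact_mod_cast hn) hα0 hα hr0 (by positivity)
        (one_div_le_coth hr0) hl).trans_eq ?_
      have := (Real.rpow_pos_of_pos hr0 α).ne'
      rw [Real.rpow_sub hr0, Real.rpow_add hr0, Real.rpow_neg hr0.le, Real.rpow_two]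
      field_simp)
  have hGa : G a = 0 := by simp [G, hfa]
  have hGb : G b = 0 := by simp [G, hfb]
  have hsub := integral_sub (hiL.sub (hi2.const_mul (l ^ 2))) (hi0.const_mul (l * n / 2))
  simp only [Pi.sub_apply] at hsub
  rw [intervalIntegral.integral_of_le hab, ← integral_Icc_eq_integral_Ioc, hsub,
    integral_sub hiL (hi2.const_mul _), integral_const_mul, integral_const_mul] at hle
  simp only [hGa, hGb, mul_zero, sub_zero] at hle
  linarith

theorem contDiff_uncurry_radGrad {N : ℕ} {u : ℝ → EuclideanSpace ℝ (Fin N) → ℝ}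
    (hu : ContDiff ℝ (⊤ : ℕ∞) (Function.uncurry u)) :
    ContDiff ℝ (⊤ : ℕ∞) (Function.uncurry (radGrad N u)) := by
  have h : Function.uncurry (radGrad N u) =
      fun p => fderiv ℝ (Function.uncurry u) p ((1 : ℝ), (0 : EuclideanSpace ℝ (Fin N))) := by
    ext ⟨r, σ⟩
    have hd : HasFDerivAt (Function.uncurry u) (fderiv ℝ (Function.uncurry u) (r, σ)) (r, σ) :=
      (hu.differentiable (by simp) (r, σ)).hasFDerivAt
    have hp : HasDerivAt (fun s : ℝ => (s, σ)) ((1 : ℝ), (0 : EuclideanSpace ℝ (Fin N))) r :=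
      (hasDerivAt_id r).prodMk (hasDerivAt_const r σ)
    exact (hd.comp_hasDerivAt r hp).deriv
  rw [h]
  exact (hu.fderiv_right (by simp)).clm_apply contDiff_const

theorem hypInt_eq_setIntegral_Icc {N : ℕ} {F : ℝ → EuclideanSpace ℝ (Fin N) → ℝ} {a b : ℝ}
    (ha : 0 < a)
    (hF : ∀ r : ℝ, r ∉ Icc a b → ∀ σ ∈ Metric.sphere (0 : EuclideanSpace ℝ (Fin N)) 1,
      F r σ = 0) :
    hypInt N F = ∫ σ in Metric.sphere (0 : EuclideanSpace ℝ (Fin N)) 1,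
      (∫ r in Icc a b, F r σ * Real.sinh r ^ (N - 1)) ∂μH[(N : ℝ) - 1] := by
  refine setIntegral_congr_fun Metric.isClosed_sphere.measurableSet fun σ hσ => ?_
  refine setIntegral_eq_of_subset_of_forall_sdiff_eq_zero measurableSet_Ioi
    (fun r hr => ha.trans_le hr.1) fun r hr => ?_
  simp [hF r hr.2 σ hσ]

theorem integrableOn_sphere_setIntegral {N : ℕ} (hN : 1 ≤ N)
    {F : ℝ → EuclideanSpace ℝ (Fin N) → ℝ} {a b : ℝ} (ha : 0 < a)
    (hF : ContinuousOn (Function.uncurry F) (Ioi 0 ×ˢ univ)) :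
    IntegrableOn (fun σ => ∫ r in Icc a b, F r σ)
      (Metric.sphere (0 : EuclideanSpace ℝ (Fin N)) 1) μH[(N : ℝ) - 1] := by
  have hcont : Continuous fun σ => ∫ r in Icc a b, F (max a r) σ := by
    refine continuous_parametric_integral_of_continuous
      (f := fun σ r => F (max a r) σ) ?_ isCompact_Icc
    exact hF.comp_continuous (f := fun p : EuclideanSpace ℝ (Fin N) × ℝ => (max a p.2, p.1))
      (by fun_prop) fun p => ⟨ha.trans_le (le_max_left _ _), trivial⟩
  have heq : (fun σ => ∫ r in Icc a b, F r σ) = fun σ => ∫ r in Icc a b, F (max a r) σ := by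
    ext σ
    exact setIntegral_congr_fun measurableSet_Icc fun r hr => by simp [max_eq_right hr.1]
  rw [heq]
  exact hcont.continuousOn.integrableOn_of_subset_isCompact (isCompact_sphere _ _)
    Metric.isClosed_sphere.measurableSet subset_rfl (hausdorffMeasure_sphere_lt_top N hN).ne

theorem radGrad_eq_zero_of_notMem_Icc {N : ℕ} {u : ℝ → EuclideanSpace ℝ (Fin N) → ℝ} {a b : ℝ}
    {σ : EuclideanSpace ℝ (Fin N)} (hu : ∀ r ∉ Icc a b, u r σ = 0) :
    ∀ r ∉ Icc a b, radGrad N u r σ = 0 := by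
  intro r hr
  have : (fun s => u s σ) =ᶠ[nhds r] fun _ => 0 :=
    Filter.eventually_of_mem (isClosed_Icc.isOpen_compl.mem_nhds hr) hu
  simp [radGrad, this.deriv_eq]

theorem eq_zero_endpoints {f : ℝ → ℝ} (hf : Continuous f) {a b : ℝ}
    (h : ∀ r ∉ Icc a b, f r = 0) : f a = 0 ∧ f b = 0 := by
  have hl : EqOn f (fun _ => 0) (closure (Iio a)) :=
    EqOn.closure (fun r hr => h r fun h' => not_le.2 hr h'.1) hf continuous_const
  have hr : EqOn f (fun _ => 0) (closure (Ioi b)) :=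
    EqOn.closure (fun r hr => h r fun h' => not_le.2 hr h'.2) hf continuous_const
  exact ⟨hl (by simp), hr (by simp)⟩

/-- Weighted Rellich inequality with radial Laplacian on `ℍ^N` for `0 ≤ α < N-2`. -/
theorem weighted_radial_rellich' (N : ℕ) (hN : 3 ≤ N) (α : ℝ)
    (hα0 : 0 ≤ α) (hα : α < (N : ℝ) - 2)
    (u : ℝ → EuclideanSpace ℝ (Fin N) → ℝ) (hu : IsCcAway N u) :
    hypInt N (fun r σ => (radLap N u r σ) ^ 2 / r ^ (α - 2)) ≥
      (((N : ℝ) - 2 - α) ^ 2 * ((N : ℝ) - 2 + α) ^ 2 / 16) *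
          hypInt N (fun r σ => (u r σ) ^ 2 / r ^ (α + 2))
      + (((N : ℝ) - 2 - α) * ((N : ℝ) - 2 + α) * ((N : ℝ) - 1) / 8) *
          hypInt N (fun r σ => (u r σ) ^ 2 / r ^ α) := by
  obtain ⟨hsm, a, b, ha, hab, hsupp⟩ := hu
  have hcast : ((N - 1 : ℕ) : ℝ) = (N : ℝ) - 1 := by
    rw [Nat.cast_sub (by omega), Nat.cast_one]
  have hsm1 := contDiff_uncurry_radGrad hsm
  have hsm2 := contDiff_uncurry_radGrad hsm1
  have hlap : ∀ r σ, radLap N u r σ = radGrad N (radGrad N u) r σ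
      + ((N : ℝ) - 1) * (Real.cosh r / Real.sinh r) * radGrad N u r σ := fun r σ => rfl
  have hlap0 : ∀ r : ℝ, r ∉ Icc a b → ∀ σ ∈ Metric.sphere (0 : EuclideanSpace ℝ (Fin N)) 1,
      radLap N u r σ = 0 := by
    intro r hr σ hσ
    have h1 := radGrad_eq_zero_of_notMem_Icc fun s hs => hsupp s hs σ hσ
    rw [hlap, h1 r hr, radGrad_eq_zero_of_notMem_Icc h1 r hr]
    simp
  have hpow : ∀ β : ℝ, ContinuousOn (fun p : ℝ × EuclideanSpace ℝ (Fin N) => p.1 ^ β)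
      (Ioi 0 ×ˢ univ) := fun β =>
    continuousOn_fst.rpow_const fun p hp => Or.inl (ne_of_gt hp.1)
  have hpow0 : ∀ β : ℝ, ∀ p ∈ Ioi (0 : ℝ) ×ˢ (univ : Set (EuclideanSpace ℝ (Fin N))),
      p.1 ^ β ≠ 0 := fun β p hp => (Real.rpow_pos_of_pos hp.1 β).ne'
  have hsinh : ContinuousOn (fun p : ℝ × EuclideanSpace ℝ (Fin N) => Real.sinh p.1 ^ (N - 1))
      (Ioi 0 ×ˢ univ) := by fun_prop
  have hcoth : ContinuousOn
      (fun p : ℝ × EuclideanSpace ℝ (Fin N) => Real.cosh p.1 / Real.sinh p.1)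
      (Ioi 0 ×ˢ univ) :=
    ContinuousOn.div (by fun_prop) (by fun_prop) fun p hp => (Real.sinh_pos_iff.2 hp.1).ne'
  have hi : ∀ β : ℝ, IntegrableOn
      (fun σ => ∫ r in Icc a b, u r σ ^ 2 / r ^ β * Real.sinh r ^ (N - 1))
      (Metric.sphere (0 : EuclideanSpace ℝ (Fin N)) 1) μH[(N : ℝ) - 1] := fun β =>
    integrableOn_sphere_setIntegral (by omega) ha
      (((hsm.continuous.pow 2).continuousOn.div (hpow β) (hpow0 β)).mul hsinh)
  have hiL : IntegrableOn
      (fun σ => ∫ r in Icc a b, radLap N u r σ ^ 2 / r ^ (α - 2) * Real.sinh r ^ (N - 1))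
      (Metric.sphere (0 : EuclideanSpace ℝ (Fin N)) 1) μH[(N : ℝ) - 1] :=
    integrableOn_sphere_setIntegral (by omega) ha
      ((((hsm2.continuous.continuousOn.add ((continuousOn_const.mul hcoth).mul
        hsm1.continuous.continuousOn)).pow 2).div (hpow _) (hpow0 _)).mul hsinh)
  have hint : ∀ β : ℝ, hypInt N (fun r σ => u r σ ^ 2 / r ^ β) = _ := fun β =>
    hypInt_eq_setIntegral_Icc (b := b) ha fun r hr σ hσ => by simp [hsupp r hr σ hσ]
  have hintL : hypInt N (fun r σ => radLap N u r σ ^ 2 / r ^ (α - 2)) = _ :=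
    hypInt_eq_setIntegral_Icc (b := b) ha fun r hr σ hσ => by simp [hlap0 r hr σ hσ]
  rw [ge_iff_le, hintL, hint, hint,
    ← integral_const_mul, ← integral_const_mul,
    ← integral_add ((hi _).const_mul _) ((hi _).const_mul _)]
  refine setIntegral_mono_on (((hi _).const_mul _).add ((hi _).const_mul _)) hiL
    Metric.isClosed_sphere.measurableSet fun σ hσ => ?_
  have hf : ContDiff ℝ (⊤ : ℕ∞) fun r => u r σ :=
    hsm.comp (contDiff_id.prodMk contDiff_const)
  obtain ⟨hfa, hfb⟩ := eq_zero_endpoints hf.continuous fun r hr => hsupp r hr σ hσ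
  have key := integral_rellich_le (n := N - 1) (by omega) hα0 (by rw [hcast]; linarith) rfl ha
    hab (contDiff_infty.1 hf 2) hfa hfb
  rw [hcast] at key
  refine le_of_eq_of_le ?_ key
  ring
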